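/- arXiv:2509.08163 — 2 statements merged into one kernel-verified Lean document; each statement's English description precedes it below -/
import Mathlib

section
/- Let n ≥ 4 and let x_1,…,x_n be a sample in ℝ^p and y_1,…,y_n a sample in ℝ^q. Then the U-centred form of the unbiased distance covariance estimator equals its expanded form: (1/(n(n−3)))·Σ_{i=1}^n Σ_{j=1}^n Ũ_x(i,j)·Ũ_y(i,j) = (1/(n(n−3)))·[ Σ_{k=1}^n Σ_{l=1}^n ‖x_k−x_l‖·‖y_k−y_l‖ + (1/((n−1)(n−2)))·(Σ_{k,l} ‖x_k−x_l‖)·(Σ_{k,l} ‖y_k−y_l‖) − (2/(n−2))·Σ_{k=1}^n (Σ_{l=1}^n ‖x_k−x_l‖)·(Σ_{l=1}^n ‖y_k−y_l‖) ]. -/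
noncomputable section

/-- The U-centred matrix of a sample `x : Fin n → E`. -/
def Ucen {E : Type*} [NormedAddCommGroup E] (n : ℕ) (x : Fin n → E)
    (i j : Fin n) : ℝ :=
  if i = j then 0
  else
    ‖x i - x j‖ - (1 / ((n : ℝ) - 2)) * ∑ l : Fin n, ‖x i - x l‖
      - (1 / ((n : ℝ) - 2)) * ∑ k : Fin n, ‖x k - x j‖
      + (1 / (((n : ℝ) - 1) * ((n : ℝ) - 2))) *
          ∑ k : Fin n, ∑ l : Fin n, ‖x k - x l‖

theorem Ucen_symm {E : Type*} [NormedAddCommGroup E] (n : ℕ) (x : Fin n → E) (i j : Fin n) :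
    Ucen n x i j = Ucen n x j i := by
  have h (a : Fin n) : ∑ k : Fin n, ‖x k - x a‖ = ∑ k : Fin n, ‖x a - x k‖ :=
    Finset.sum_congr rfl fun k _ => norm_sub_rev _ _
  simp only [Ucen, eq_comm (a := i), h, norm_sub_rev (x i) (x j)]
  split_ifs
  · rfl
  · ring

/-- The rows of a U-centred matrix sum to zero. -/
theorem sum_Ucen_eq_zero {E : Type*} [NormedAddCommGroup E] (n : ℕ) (hn : 3 ≤ n)
    (x : Fin n → E) (i : Fin n) : ∑ j : Fin n, Ucen n x i j = 0 := by
  have hn' : (3 : ℝ) ≤ n := by exact_mod_cast hn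
  have h1 : (n : ℝ) - 1 ≠ 0 := by linarith
  have h2 : (n : ℝ) - 2 ≠ 0 := by linarith
  have h (j : Fin n) : Ucen n x i j =
      (‖x i - x j‖ - (1 / ((n : ℝ) - 2)) * ∑ l : Fin n, ‖x i - x l‖
        - (1 / ((n : ℝ) - 2)) * ∑ k : Fin n, ‖x k - x j‖
        + (1 / (((n : ℝ) - 1) * ((n : ℝ) - 2))) * ∑ k : Fin n, ∑ l : Fin n, ‖x k - x l‖)
      - if i = j then
          (1 / (((n : ℝ) - 1) * ((n : ℝ) - 2))) * (∑ k : Fin n, ∑ l : Fin n, ‖x k - x l‖)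
            - (2 / ((n : ℝ) - 2)) * ∑ l : Fin n, ‖x i - x l‖
        else 0 := by
    unfold Ucen
    split_ifs with hij
    · subst hij
      simp only [sub_self, norm_zero, fun k => norm_sub_rev (x k) (x i)]
      ring
    · ring
  simp only [h, Finset.sum_sub_distrib, Finset.sum_add_distrib, ← Finset.mul_sum,
    Finset.sum_const, Finset.sum_ite_eq, Finset.mem_univ, if_true, Finset.card_univ,
    Fintype.card_fin, nsmul_eq_mul]
  rw [Finset.sum_comm (f := fun j k => ‖x k - x j‖)]
  field_simp
  ring

/-- Pairing with a U-centred matrix does not see the centring of the other matrix. -/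
theorem sum_Ucen_mul_Ucen {E F : Type*} [NormedAddCommGroup E] [NormedAddCommGroup F]
    (n : ℕ) (hn : 3 ≤ n) (x : Fin n → E) (y : Fin n → F) :
    ∑ i : Fin n, ∑ j : Fin n, Ucen n x i j * Ucen n y i j =
      ∑ i : Fin n, ∑ j : Fin n, Ucen n x i j * ‖y i - y j‖ := by
  have h (i j : Fin n) : Ucen n x i j * Ucen n y i j =
      Ucen n x i j * ‖y i - y j‖
        - Ucen n x i j * ((1 / ((n : ℝ) - 2)) * ∑ l : Fin n, ‖y i - y l‖)
        - Ucen n x i j * ((1 / ((n : ℝ) - 2)) * ∑ k : Fin n, ‖y k - y j‖)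
        + Ucen n x i j * ((1 / (((n : ℝ) - 1) * ((n : ℝ) - 2))) *
          ∑ k : Fin n, ∑ l : Fin n, ‖y k - y l‖) := by
    by_cases hij : i = j
    · simp [Ucen, hij]
    · rw [Ucen.eq_def n y, if_neg hij]
      ring
  have hcol (j : Fin n) : ∑ i : Fin n, Ucen n x i j = 0 := by
    simp only [Ucen_symm n x _ j, sum_Ucen_eq_zero n hn]
  simp only [h, Finset.sum_sub_distrib, Finset.sum_add_distrib]
  rw [Finset.sum_comm (f := fun i j =>
    Ucen n x i j * ((1 / ((n : ℝ) - 2)) * ∑ k : Fin n, ‖y k - y j‖))]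
  simp only [← Finset.sum_mul, sum_Ucen_eq_zero n hn, hcol, zero_mul, Finset.sum_const_zero]
  ring

/-- The U-centred form of the unbiased distance covariance estimator equals
its expanded form. -/
theorem ucentred_dcov_eq_expanded (n p q : ℕ) (hn : 4 ≤ n)
    (x : Fin n → EuclideanSpace ℝ (Fin p))
    (y : Fin n → EuclideanSpace ℝ (Fin q)) :
    (1 / ((n : ℝ) * ((n : ℝ) - 3))) *
        ∑ i : Fin n, ∑ j : Fin n, Ucen n x i j * Ucen n y i j =
      (1 / ((n : ℝ) * ((n : ℝ) - 3))) *
        ((∑ k : Fin n, ∑ l : Fin n, ‖x k - x l‖ * ‖y k - y l‖)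
          + (1 / (((n : ℝ) - 1) * ((n : ℝ) - 2))) *
              (∑ k : Fin n, ∑ l : Fin n, ‖x k - x l‖) *
              (∑ k : Fin n, ∑ l : Fin n, ‖y k - y l‖)
          - (2 / ((n : ℝ) - 2)) *
              ∑ k : Fin n, (∑ l : Fin n, ‖x k - x l‖) *
                (∑ l : Fin n, ‖y k - y l‖)) := by
  congr 1
  rw [sum_Ucen_mul_Ucen n (by omega)]
  have h (i j : Fin n) : Ucen n x i j * ‖y i - y j‖ =
      ‖x i - x j‖ * ‖y i - y j‖
        - (1 / ((n : ℝ) - 2)) * ((∑ l : Fin n, ‖x i - x l‖) * ‖y i - y j‖)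
        - (1 / ((n : ℝ) - 2)) * ((∑ l : Fin n, ‖x j - x l‖) * ‖y j - y i‖)
        + (1 / (((n : ℝ) - 1) * ((n : ℝ) - 2))) *
          ((∑ k : Fin n, ∑ l : Fin n, ‖x k - x l‖) * ‖y i - y j‖) := by
    by_cases hij : i = j
    · simp [hij]
    · rw [Ucen, if_neg hij, norm_sub_rev (y j)]
      simp only [fun k => norm_sub_rev (x k) (x j)]
      ring
  simp only [h, Finset.sum_sub_distrib, Finset.sum_add_distrib, ← Finset.mul_sum]
  rw [Finset.sum_comm (f := fun i j => (∑ l : Fin n, ‖x j - x l‖) * ‖y j - y i‖)]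
  simp only [← Finset.mul_sum]
  ring
end
end

section
/- Let n ≥ 4, d ≥ 2, and for each k ∈ {1,…,d} let x_{1,k},…,x_{n,k} be a sample in ℝ^{p_k}. Then the bias-corrected joint distance covariance estimator decomposes into pairwise unbiased distance covariance estimators plus a higher-order term: (1/(n(n−3)))·Σ_{i=1}^n Σ_{j=1}^n [ Π_{k=1}^d (Ũ_{x_k}(i,j) + 1) − 1 ] = Σ_{1≤k<l≤d} (1/(n(n−3)))·Σ_{i,j} Ũ_{x_k}(i,j)·Ũ_{x_l}(i,j) + ζ, where ζ = Σ_{I ⊆ {1,…,d}, |I| ≥ 3} (1/(n(n−3)))·Σ_{i=1}^n Σ_{j=1}^n Π_{k∈I} Ũ_{x_k}(i,j). -/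
noncomputable section

/-- The second elementary symmetric sum, written over ordered pairs `k < l`. -/
theorem sum_powersetCard_two_prod {ι R : Type*} [Fintype ι] [LinearOrder ι] [CommSemiring R]
    (f : ι → R) :
    ∑ I ∈ Finset.powersetCard 2 (Finset.univ : Finset ι), ∏ k ∈ I, f k =
      ∑ k, ∑ l, if k < l then f k * f l else 0 := by
  rw [← Fintype.sum_prod_type' (fun k l => if k < l then f k * f l else 0),
    ← Finset.sum_filter (fun q : ι × ι => q.1 < q.2) (fun q => f q.1 * f q.2)]
  symm
  refine Finset.sum_bij (fun q _ => {q.1, q.2}) ?_ ?_ ?_ ?_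
  · rintro ⟨a, b⟩ h
    simp only [Finset.mem_filter, Finset.mem_univ, true_and] at h
    simp [Finset.card_pair h.ne]
  · rintro ⟨a, b⟩ h ⟨c, e⟩ h' heq
    simp only [Finset.mem_filter, Finset.mem_univ, true_and] at h h' heq
    have hc : c ∈ ({a, b} : Finset ι) := by simp [heq]
    have he : e ∈ ({a, b} : Finset ι) := by simp [heq]
    simp only [Finset.mem_insert, Finset.mem_singleton] at hc he
    grind
  · intro I hI
    obtain ⟨a, b, hab, rfl⟩ := Finset.card_eq_two.mp (Finset.mem_powersetCard.mp hI).2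
    rcases lt_or_gt_of_ne hab with h | h
    · exact ⟨(a, b), by simpa using h, rfl⟩
    · exact ⟨(b, a), by simpa using h, Finset.pair_comm b a⟩
  · rintro ⟨a, b⟩ h
    simp only [Finset.mem_filter, Finset.mem_univ, true_and] at h
    exact (Finset.prod_pair h.ne).symm

/-- Expansion of `∏ (f k + 1) - 1` with the terms of degree one and two separated. -/
theorem prod_add_one_sub_one_eq {ι R : Type*} [Fintype ι] [LinearOrder ι] [CommRing R]
    (f : ι → R) :
    (∏ k, (f k + 1)) - 1 =
      ∑ k, f k + (∑ k, ∑ l, if k < l then f k * f l else 0)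
        + ∑ I ∈ Finset.univ.powerset.filter (fun I : Finset ι => 3 ≤ I.card), ∏ k ∈ I, f k := by
  have h0 : ∑ I ∈ Finset.powersetCard 0 (Finset.univ : Finset ι), ∏ k ∈ I, f k = 1 := by simp
  have h1 : ∑ I ∈ Finset.powersetCard 1 (Finset.univ : Finset ι), ∏ k ∈ I, f k = ∑ k, f k := by
    simp [Finset.powersetCard_one]
  have key : ∑ I ∈ (Finset.univ : Finset ι).powerset, ∏ k ∈ I, f k =
      ∑ I ∈ Finset.powersetCard 0 (Finset.univ : Finset ι), ∏ k ∈ I, f k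
        + ∑ I ∈ Finset.powersetCard 1 (Finset.univ : Finset ι), ∏ k ∈ I, f k
        + ∑ I ∈ Finset.powersetCard 2 (Finset.univ : Finset ι), ∏ k ∈ I, f k
        + ∑ I ∈ Finset.univ.powerset.filter (fun I : Finset ι => 3 ≤ I.card),
            ∏ k ∈ I, f k := by
    simp only [Finset.powersetCard_eq_filter, Finset.sum_filter, ← Finset.sum_add_distrib]
    refine Finset.sum_congr rfl fun I _ => ?_
    split_ifs <;> first | omega | simp
  rw [Finset.prod_add_one, key, h0, h1, sum_powersetCard_two_prod]
  ring

/-- The rows of a U-centred matrix sum to zero. -/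
theorem sum_Ucen {E : Type*} [NormedAddCommGroup E] {n : ℕ} (hn : 3 ≤ n) (x : Fin n → E)
    (i : Fin n) : ∑ j, Ucen n x i j = 0 := by
  have hn' : (3 : ℝ) ≤ n := by exact_mod_cast hn
  have h1 : (n : ℝ) - 1 ≠ 0 := by linarith
  have h2 : (n : ℝ) - 2 ≠ 0 := by linarith
  set S := ∑ k, ∑ l, ‖x k - x l‖ with hS
  set r := ∑ l, ‖x i - x l‖ with hr
  have hcol : ∑ k, ‖x k - x i‖ = r :=
    Finset.sum_congr rfl fun k _ => norm_sub_rev _ _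
  have hcols : ∑ j, ∑ k, ‖x k - x j‖ = S := Finset.sum_comm
  have hU : ∀ j, Ucen n x i j =
      (‖x i - x j‖ - 1 / ((n : ℝ) - 2) * r - 1 / ((n : ℝ) - 2) * ∑ k, ‖x k - x j‖
        + 1 / (((n : ℝ) - 1) * ((n : ℝ) - 2)) * S)
      - if i = j then -(2 / ((n : ℝ) - 2)) * r + 1 / (((n : ℝ) - 1) * ((n : ℝ) - 2)) * S
        else 0 := by
    intro j
    unfold Ucen
    split_ifs with h
    · subst h
      rw [hcol, sub_self, norm_zero]
      ring
    · rw [sub_zero]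
  simp only [hU, Finset.sum_sub_distrib, Finset.sum_add_distrib, ← Finset.mul_sum, hcols,
    Finset.sum_ite_eq, Finset.mem_univ, if_true, Finset.sum_const, Finset.card_univ,
    Fintype.card_fin, nsmul_eq_mul, ← hr]
  field_simp
  ring

/-- The bias-corrected joint distance covariance estimator decomposes into the
pairwise unbiased distance covariance estimators plus the higher-order term ζ
ranging over subsets of size at least 3. -/
theorem jdcov_decomposition (n d : ℕ) (hn : 4 ≤ n) (hd : 2 ≤ d)
    (p : Fin d → ℕ) (x : (k : Fin d) → Fin n → EuclideanSpace ℝ (Fin (p k))) :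
    (1 / ((n : ℝ) * ((n : ℝ) - 3))) *
        ∑ i : Fin n, ∑ j : Fin n, ((∏ k : Fin d, (Ucen n (x k) i j + 1)) - 1) =
      (∑ k : Fin d, ∑ l : Fin d,
          if k < l then
            (1 / ((n : ℝ) * ((n : ℝ) - 3))) *
              ∑ i : Fin n, ∑ j : Fin n, Ucen n (x k) i j * Ucen n (x l) i j
          else 0)
        + ∑ I ∈ Finset.univ.powerset.filter (fun I : Finset (Fin d) => 3 ≤ I.card),
            (1 / ((n : ℝ) * ((n : ℝ) - 3))) *
              ∑ i : Fin n, ∑ j : Fin n, ∏ k ∈ I, Ucen n (x k) i j := by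
  have hlin : ∑ i : Fin n, ∑ j : Fin n, ∑ k : Fin d, Ucen n (x k) i j = 0 := by
    refine Finset.sum_eq_zero fun i _ => ?_
    rw [Finset.sum_comm]
    exact Finset.sum_eq_zero fun k _ => sum_Ucen (by omega) (x k) i
  have hpair : ∑ i : Fin n, ∑ j : Fin n, ∑ k : Fin d, ∑ l : Fin d,
      (if k < l then Ucen n (x k) i j * Ucen n (x l) i j else 0) =
      ∑ k : Fin d, ∑ l : Fin d, if k < l then
        ∑ i : Fin n, ∑ j : Fin n, Ucen n (x k) i j * Ucen n (x l) i j else 0 := by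
    simp_rw [Finset.sum_comm (s := (Finset.univ : Finset (Fin n)))
      (t := (Finset.univ : Finset (Fin d)))]
    refine Finset.sum_congr rfl fun k _ => Finset.sum_congr rfl fun l _ => ?_
    split_ifs <;> simp
  have hhigh : ∑ i : Fin n, ∑ j : Fin n,
      ∑ I ∈ Finset.univ.powerset.filter (fun I : Finset (Fin d) => 3 ≤ I.card),
        ∏ k ∈ I, Ucen n (x k) i j =
      ∑ I ∈ Finset.univ.powerset.filter (fun I : Finset (Fin d) => 3 ≤ I.card),
        ∑ i : Fin n, ∑ j : Fin n, ∏ k ∈ I, Ucen n (x k) i j := by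
    conv_rhs => rw [Finset.sum_comm]
    refine Finset.sum_congr rfl fun i _ => ?_
    exact Finset.sum_comm
  simp only [prod_add_one_sub_one_eq, Finset.sum_add_distrib, hlin, hpair, hhigh, zero_add,
    mul_add, Finset.mul_sum, mul_ite, mul_zero]
end
end
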